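/- arXiv:1109.1913 — 2 statements merged into one kernel-verified Lean document; each statement's English description precedes it below -/
import Mathlib

section
/- Every (√2, 2−√2)-identifying code C ⊆ ℤ² satisfies D(C) ≥ 16/57; that is, D(√2, 2−√2) ≥ 16/57. -/
open Filter

def ball (r : ℝ) (u : ℤ × ℤ) : Set (ℤ × ℤ) :=
  {v : ℤ × ℤ | ((v.1 - u.1 : ℤ) : ℝ) ^ 2 + ((v.2 - u.2 : ℤ) : ℝ) ^ 2 ≤ r ^ 2}

def Spat (r Δ : ℝ) (u v : ℤ × ℤ) : Set (ℤ × ℤ) :=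
  (ball r u \ ball (r + Δ) v) ∪ (ball r v \ ball (r + Δ) u)

def IsIdCode (r Δ : ℝ) (C : Set (ℤ × ℤ)) : Prop :=
  (∀ u : ℤ × ℤ, (ball r u ∩ C).Nonempty) ∧
    ∀ u v : ℤ × ℤ, u ≠ v → (Spat r Δ u v ∩ C).Nonempty

def Qset (n : ℕ) : Set (ℤ × ℤ) := {p : ℤ × ℤ | |p.1| ≤ (n : ℤ) ∧ |p.2| ≤ (n : ℤ)}

noncomputable def density (C : Set (ℤ × ℤ)) : ℝ :=
  Filter.limsup
    (fun n : ℕ => (Nat.card ↥(C ∩ Qset n) : ℝ) / ((2 * (n : ℝ) + 1) ^ 2))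
    Filter.atTop

def IntersectsDiagMod (U : Set (ℤ × ℤ)) (k : ℕ) : Prop :=
  ∀ i : ℤ, ∃ p ∈ U, Int.ModEq (k : ℤ) (p.2 - p.1) i

def IntersectsAntiDiagMod (U : Set (ℤ × ℤ)) (k : ℕ) : Prop :=
  ∀ i : ℤ, ∃ p ∈ U, Int.ModEq (k : ℤ) (p.1 + p.2) i

def IntersectsHorizMod (U : Set (ℤ × ℤ)) (k : ℕ) : Prop :=
  ∀ i : ℤ, ∃ p ∈ U, Int.ModEq (k : ℤ) p.2 i

noncomputable def diagNum (U : Set (ℤ × ℤ)) : ℕ :=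
  sSup {k : ℕ | 0 < k ∧ IntersectsDiagMod U k}

def Lv (k : ℕ) : Set (ℤ × ℤ) := {p : ℤ × ℤ | (k : ℤ) ∣ p.1}
def Lh (k : ℕ) : Set (ℤ × ℤ) := {p : ℤ × ℤ | (k : ℤ) ∣ p.2}
def Ld (k : ℕ) : Set (ℤ × ℤ) := {p : ℤ × ℤ | (k : ℤ) ∣ (p.2 - p.1)}

/-- The membership pattern of five vertically consecutive points. -/
structure Col where
  (p0 p1 p2 p3 p4 : Bool)

namespace Col

/-- `P` holds for both values of a bit of weight `w`, added to the weight `t`, as long as the total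
stays below `T`. -/
def bitLt (T w t : ℕ) (P : Bool → ℕ → Bool) : Bool :=
  P false t && (Nat.ble T (t + w) || P true (t + w))

/-- `P` holds for all columns whose weight, added to `t`, stays below `T`. The weights are
symmetric: `u` for the end cells, `v` for their neighbours, `w` for the middle cell. -/
def allLt (T u v w t : ℕ) (P : Col → ℕ → Bool) : Bool :=
  bitLt T u t fun a t => bitLt T v t fun b t => bitLt T w t fun c t =>
    bitLt T v t fun d t => bitLt T u t fun e t => P ⟨a, b, c, d, e⟩ t

def weight (u v w : ℕ) (a : Col) : ℕ :=
  u * a.p0.toNat + v * a.p1.toNat + w * a.p2.toNat + v * a.p3.toNat + u * a.p4.toNat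

theorem of_bitLt {T w t : ℕ} {P : Bool → ℕ → Bool} (h : bitLt T w t P = true) (a : Bool)
    (ht : t + w * a.toNat < T) : P a (t + w * a.toNat) = true := by
  rw [bitLt, Bool.and_eq_true, Bool.or_eq_true, Nat.ble_eq] at h
  cases a
  · simpa using h.1
  · simp only [Bool.toNat_true, mul_one] at ht ⊢
    exact h.2.resolve_left (by omega)

theorem of_allLt {T u v w t : ℕ} {P : Col → ℕ → Bool} (h : allLt T u v w t P = true) (a : Col)
    (ht : t + a.weight u v w < T) : P a (t + a.weight u v w) = true := by
  obtain ⟨a, b, c, d, e⟩ := a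
  simp only [weight, ← add_assoc] at ht ⊢
  exact of_bitLt (of_bitLt (of_bitLt (of_bitLt (of_bitLt h a (by omega)) b (by omega))
    c (by omega)) d (by omega)) e ht

/-- Columns at distance `3`: horizontally adjacent points are separated. -/
def sepH (a d : Col) : Bool :=
  (a.p0 || a.p2 || d.p0 || d.p2) && (a.p1 || a.p3 || d.p1 || d.p3) &&
    (a.p2 || a.p4 || d.p2 || d.p4)

/-- Columns at distance `2`: vertically adjacent points are separated. -/
def sepV (a c : Col) : Bool :=
  (a.p0 || a.p3 || c.p0 || c.p3) && (a.p1 || a.p4 || c.p1 || c.p4)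

/-- Three consecutive columns: every point is covered. -/
def cover (a b c : Col) : Bool :=
  (a.p0 || a.p1 || a.p2 || b.p0 || b.p1 || b.p2 || c.p0 || c.p1 || c.p2) &&
  (a.p1 || a.p2 || a.p3 || b.p1 || b.p2 || b.p3 || c.p1 || c.p2 || c.p3) &&
  (a.p2 || a.p3 || a.p4 || b.p2 || b.p3 || b.p4 || c.p2 || c.p3 || c.p4)

/-- Four consecutive columns: diagonally adjacent points are separated. -/
def sepD (a b c d : Col) : Bool :=
  (a.p0 || a.p1 || b.p0 || c.p3 || d.p2 || d.p3) &&
  (a.p1 || a.p2 || b.p1 || c.p4 || d.p3 || d.p4) &&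
  (a.p2 || a.p3 || b.p3 || c.p0 || d.p0 || d.p1) &&
  (a.p3 || a.p4 || b.p4 || c.p1 || d.p1 || d.p2)

/-- Search over the windows `c₀, …, c₅` of weight less than `12`; the inner columns come first. -/
def windowCheck : Bool :=
  allLt 9 2 2 1 0 fun c2 t => allLt 9 2 2 1 t fun c3 t =>
    allLt 9 1 1 1 t fun c0 t => !sepH c0 c3 || !sepV c0 c2 ||
      allLt 9 1 1 1 t fun c5 t => !sepH c2 c5 || !sepV c3 c5 ||
        allLt 12 1 2 1 t fun c1 t => !sepV c1 c3 || !cover c0 c1 c2 || !cover c1 c2 c3 ||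
          !sepD c0 c1 c2 c3 ||
          allLt 12 1 2 1 t fun c4 _ => !sepH c1 c4 || !sepV c2 c4 || !cover c2 c3 c4 ||
            !cover c3 c4 c5 || !sepD c1 c2 c3 c4 || !sepD c2 c3 c4 c5

theorem windowCheck_eq_true : windowCheck = true := by
  decide +kernel

theorem three_le_weight_add_weight {a d : Col} (h : sepH a d = true) :
    3 ≤ a.weight 1 2 1 + d.weight 1 2 1 := by
  obtain ⟨a0, a1, a2, a3, a4⟩ := a
  obtain ⟨d0, d1, d2, d3, d4⟩ := d
  revert h
  revert a0 a1 a2 a3 a4 d0 d1 d2 d3 d4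
  decide +kernel

theorem twelve_le_weight {c0 c1 c2 c3 c4 c5 : Col}
    (h03 : sepH c0 c3 = true) (h14 : sepH c1 c4 = true) (h25 : sepH c2 c5 = true)
    (v02 : sepV c0 c2 = true) (v13 : sepV c1 c3 = true) (v24 : sepV c2 c4 = true)
    (v35 : sepV c3 c5 = true)
    (k0 : cover c0 c1 c2 = true) (k1 : cover c1 c2 c3 = true) (k2 : cover c2 c3 c4 = true)
    (k3 : cover c3 c4 c5 = true)
    (d0 : sepD c0 c1 c2 c3 = true) (d1 : sepD c1 c2 c3 c4 = true)
    (d2 : sepD c2 c3 c4 c5 = true) :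
    12 ≤ c0.weight 1 1 1 + c1.weight 1 2 1 + c2.weight 2 2 1 + c3.weight 2 2 1 +
      c4.weight 1 2 1 + c5.weight 1 1 1 := by
  have hm := three_le_weight_add_weight h14
  by_contra hlt
  have h := of_allLt (of_allLt windowCheck_eq_true c2 (by omega)) c3 (by omega)
  replace h := of_allLt h c0 (by omega)
  simp only [h03, v02, Bool.not_true, Bool.false_or] at h
  replace h := of_allLt h c5 (by omega)
  simp only [h25, v35, Bool.not_true, Bool.false_or] at h
  replace h := of_allLt h c1 (by omega)
  simp only [v13, k0, k1, d0, Bool.not_true, Bool.false_or] at h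
  replace h := of_allLt h c4 (by omega)
  simp only [h14, v24, k2, k3, d1, d2, Bool.not_true, Bool.or_false] at h
  exact Bool.false_ne_true h

end Col

theorem mem_ball_sqrt_two {u v : ℤ × ℤ} :
    v ∈ ball (Real.sqrt 2) u ↔ (v.1 - u.1) ^ 2 + (v.2 - u.2) ^ 2 ≤ 2 := by
  rw [ball, Set.mem_ofPred_eq, Real.sq_sqrt (by norm_num)]
  exact_mod_cast Iff.rfl

theorem mem_ball_two {u v : ℤ × ℤ} :
    v ∈ ball (Real.sqrt 2 + (2 - Real.sqrt 2)) u ↔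
      (v.1 - u.1) ^ 2 + (v.2 - u.2) ^ 2 ≤ 4 := by
  rw [ball, Set.mem_ofPred_eq, add_sub_cancel, show (2 : ℝ) ^ 2 = 4 by norm_num]
  exact_mod_cast Iff.rfl

theorem bounds_of_mem_ball {s t : ℤ} (h : s ^ 2 + t ^ 2 ≤ 2) :
    (s = -1 ∨ s = 0 ∨ s = 1) ∧ (t = -1 ∨ t = 0 ∨ t = 1) := by
  have h1 : -1 ≤ s := by nlinarith [sq_nonneg t]
  have h2 : s ≤ 1 := by nlinarith [sq_nonneg t]
  have h3 : -1 ≤ t := by nlinarith [sq_nonneg s]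
  have h4 : t ≤ 1 := by nlinarith [sq_nonneg s]
  omega

namespace IsIdCode

variable {C : Set (ℤ × ℤ)}

theorem exists_mem_cover (hC : IsIdCode (Real.sqrt 2) (2 - Real.sqrt 2) C) (x y : ℤ) :
    ∃ s t : ℤ, (s = -1 ∨ s = 0 ∨ s = 1) ∧ (t = -1 ∨ t = 0 ∨ t = 1) ∧ (x + s, y + t) ∈ C := by
  obtain ⟨⟨p, q⟩, hp, hpC⟩ := hC.1 (x, y)
  obtain ⟨hs, ht⟩ := bounds_of_mem_ball (mem_ball_sqrt_two.1 hp)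
  exact ⟨p - x, q - y, hs, ht, by simpa using hpC⟩

/-- The code meets the set separating `(x, y)` from its translate by `(a, b)`. -/
theorem exists_mem_separator (hC : IsIdCode (Real.sqrt 2) (2 - Real.sqrt 2) C) (x y a b : ℤ)
    (hab : a ≠ 0 ∨ b ≠ 0) :
    ∃ s t : ℤ, (s = -1 ∨ s = 0 ∨ s = 1) ∧ (t = -1 ∨ t = 0 ∨ t = 1) ∧
      ((4 < (s - a) ^ 2 + (t - b) ^ 2 ∧ (x + s, y + t) ∈ C) ∨
        (4 < (s + a) ^ 2 + (t + b) ^ 2 ∧ (x + a + s, y + b + t) ∈ C)) := by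
  have hne : ((x, y) : ℤ × ℤ) ≠ (x + a, y + b) := by
    simpa [Prod.ext_iff, ← not_and_or] using hab
  obtain ⟨⟨p, q⟩, ⟨hp, hpn⟩ | ⟨hp, hpn⟩, hpC⟩ := hC.2 _ _ hne
  · obtain ⟨hs, ht⟩ := bounds_of_mem_ball (mem_ball_sqrt_two.1 hp)
    rw [mem_ball_two, not_le] at hpn
    refine ⟨p - x, q - y, hs, ht, Or.inl ⟨?_, by simpa using hpC⟩⟩
    simpa [sub_sub] using hpn
  · obtain ⟨hs, ht⟩ := bounds_of_mem_ball (mem_ball_sqrt_two.1 hp)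
    rw [mem_ball_two, not_le] at hpn
    refine ⟨p - (x + a), q - (y + b), hs, ht, Or.inr ⟨?_, by simpa using hpC⟩⟩
    rw [show p - (x + a) + a = p - x by ring, show q - (y + b) + b = q - y by ring]
    exact hpn

theorem cover (hC : IsIdCode (Real.sqrt 2) (2 - Real.sqrt 2) C) (x y : ℤ) :
    (x, y) ∈ C ∨ (x, y + 1) ∈ C ∨ (x, y + 2) ∈ C ∨
      (x + 1, y) ∈ C ∨ (x + 1, y + 1) ∈ C ∨ (x + 1, y + 2) ∈ C ∨
      (x + 2, y) ∈ C ∨ (x + 2, y + 1) ∈ C ∨ (x + 2, y + 2) ∈ C := by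
  obtain ⟨s, t, rfl | rfl | rfl, rfl | rfl | rfl, h⟩ := hC.exists_mem_cover (x + 1) (y + 1) <;>
    (norm_num [add_assoc] at h; simp [h])

theorem sepH (hC : IsIdCode (Real.sqrt 2) (2 - Real.sqrt 2) C) (x y : ℤ) :
    (x, y) ∈ C ∨ (x, y + 2) ∈ C ∨ (x + 3, y) ∈ C ∨ (x + 3, y + 2) ∈ C := by
  obtain ⟨s, t, rfl | rfl | rfl, rfl | rfl | rfl, h⟩ :=
    hC.exists_mem_separator (x + 1) (y + 1) 1 0 (by simp) <;>
    norm_num [add_assoc] at h <;> simp [h]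

theorem sepV (hC : IsIdCode (Real.sqrt 2) (2 - Real.sqrt 2) C) (x y : ℤ) :
    (x, y) ∈ C ∨ (x, y + 3) ∈ C ∨ (x + 2, y) ∈ C ∨ (x + 2, y + 3) ∈ C := by
  obtain ⟨s, t, rfl | rfl | rfl, rfl | rfl | rfl, h⟩ :=
    hC.exists_mem_separator (x + 1) (y + 1) 0 1 (by simp) <;>
    norm_num [add_assoc] at h <;> simp [h]

theorem sepD (hC : IsIdCode (Real.sqrt 2) (2 - Real.sqrt 2) C) (x y : ℤ) :
    (x, y) ∈ C ∨ (x, y + 1) ∈ C ∨ (x + 1, y) ∈ C ∨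
      (x + 2, y + 3) ∈ C ∨ (x + 3, y + 2) ∈ C ∨ (x + 3, y + 3) ∈ C := by
  obtain ⟨s, t, rfl | rfl | rfl, rfl | rfl | rfl, h⟩ :=
    hC.exists_mem_separator (x + 1) (y + 1) 1 1 (by simp) <;>
    norm_num [add_assoc] at h <;> simp [h]

theorem sepAntiD (hC : IsIdCode (Real.sqrt 2) (2 - Real.sqrt 2) C) (x y : ℤ) :
    (x, y + 2) ∈ C ∨ (x, y + 3) ∈ C ∨ (x + 1, y + 3) ∈ C ∨
      (x + 2, y) ∈ C ∨ (x + 3, y) ∈ C ∨ (x + 3, y + 1) ∈ C := by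
  obtain ⟨s, t, rfl | rfl | rfl, rfl | rfl | rfl, h⟩ :=
    hC.exists_mem_separator (x + 1) (y + 2) 1 (-1) (by simp) <;>
    norm_num [add_assoc] at h <;> simp [h]

end IsIdCode

open Classical in
/-- The column of membership bits of the points `(x, y), …, (x, y + 4)`. -/
noncomputable def colAt (C : Set (ℤ × ℤ)) (x y : ℤ) : Col :=
  ⟨decide ((x, y) ∈ C), decide ((x, y + 1) ∈ C), decide ((x, y + 2) ∈ C),
    decide ((x, y + 3) ∈ C), decide ((x, y + 4) ∈ C)⟩

section

variable {C : Set (ℤ × ℤ)}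

theorem sepH_colAt (hC : IsIdCode (Real.sqrt 2) (2 - Real.sqrt 2) C) (x y : ℤ) :
    Col.sepH (colAt C x y) (colAt C (x + 3) y) = true := by
  have h0 := hC.sepH x y
  have h1 := hC.sepH x (y + 1)
  have h2 := hC.sepH x (y + 2)
  norm_num [add_assoc] at h1 h2
  simp only [Col.sepH, colAt, Bool.and_eq_true, Bool.or_eq_true, decide_eq_true_eq]
  tauto

theorem sepV_colAt (hC : IsIdCode (Real.sqrt 2) (2 - Real.sqrt 2) C) (x y : ℤ) :
    Col.sepV (colAt C x y) (colAt C (x + 2) y) = true := by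
  have h0 := hC.sepV x y
  have h1 := hC.sepV x (y + 1)
  norm_num [add_assoc] at h1
  simp only [Col.sepV, colAt, Bool.and_eq_true, Bool.or_eq_true, decide_eq_true_eq]
  tauto

theorem cover_colAt (hC : IsIdCode (Real.sqrt 2) (2 - Real.sqrt 2) C) (x y : ℤ) :
    Col.cover (colAt C x y) (colAt C (x + 1) y) (colAt C (x + 2) y) = true := by
  have h0 := hC.cover x y
  have h1 := hC.cover x (y + 1)
  have h2 := hC.cover x (y + 2)
  norm_num [add_assoc] at h1 h2
  simp only [Col.cover, colAt, Bool.and_eq_true, Bool.or_eq_true, decide_eq_true_eq, or_assoc]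
  exact ⟨⟨h0, h1⟩, h2⟩

theorem sepD_colAt (hC : IsIdCode (Real.sqrt 2) (2 - Real.sqrt 2) C) (x y : ℤ) :
    Col.sepD (colAt C x y) (colAt C (x + 1) y) (colAt C (x + 2) y) (colAt C (x + 3) y) =
      true := by
  have h0 := hC.sepD x y
  have h1 := hC.sepD x (y + 1)
  have h2 := hC.sepAntiD x y
  have h3 := hC.sepAntiD x (y + 1)
  norm_num [add_assoc] at h1 h3
  simp only [Col.sepD, colAt, Bool.and_eq_true, Bool.or_eq_true, decide_eq_true_eq, or_assoc]
  exact ⟨⟨⟨h0, h1⟩, h2⟩, h3⟩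

end

/-- The weights of the `6 × 5` window; their sum is `42`. -/
def windowWeight : Fin 6 → Fin 5 → ℕ :=
  ![![1, 1, 1, 1, 1], ![1, 2, 1, 2, 1], ![2, 2, 1, 2, 2],
    ![2, 2, 1, 2, 2], ![1, 2, 1, 2, 1], ![1, 1, 1, 1, 1]]

open Classical in
theorem twelve_le_sum_windowWeight {C : Set (ℤ × ℤ)}
    (hC : IsIdCode (Real.sqrt 2) (2 - Real.sqrt 2) C) (p : ℤ × ℤ) :
    12 ≤ ∑ i : Fin 6, ∑ j : Fin 5,
      windowWeight i j * if p + ((i : ℤ), (j : ℤ)) ∈ C then 1 else 0 := by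
  obtain ⟨x, y⟩ := p
  have hH := fun a => sepH_colAt hC (x + a) y
  have hV := fun a => sepV_colAt hC (x + a) y
  have hK := fun a => cover_colAt hC (x + a) y
  have hD := fun a => sepD_colAt hC (x + a) y
  simp only [add_assoc] at hH hV hK hD
  have h := Col.twelve_le_weight (hH 0) (hH 1) (hH 2) (hV 0) (hV 1) (hV 2) (hV 3)
    (hK 0) (hK 1) (hK 2) (hK 3) (hD 0) (hD 1) (hD 2)
  convert h using 1
  simp [Fin.sum_univ_succ, windowWeight, Col.weight, colAt, Bool.toNat,
    Bool.cond_decide]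
  ring

open Classical in
/-- The finite set of points of `C` in the box `|x| ≤ n`, `|y| ≤ n`. -/
noncomputable def boxFinset (C : Set (ℤ × ℤ)) (n : ℕ) : Finset (ℤ × ℤ) :=
  (Finset.Icc (-n : ℤ) n ×ˢ Finset.Icc (-n : ℤ) n).filter (· ∈ C)

theorem natCard_inter_Qset (C : Set (ℤ × ℤ)) (n : ℕ) :
    Nat.card ↥(C ∩ Qset n) = (boxFinset C n).card := by
  classical
  rw [Nat.card_coe_set_eq, ← Set.ncard_coe_finset]
  congr 1
  ext p
  simp only [boxFinset, Qset, Finset.coe_filter, Finset.mem_product, Finset.mem_Icc,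
    Set.mem_inter_iff, Set.mem_ofPred_eq, abs_le]
  tauto

theorem card_boxFinset_le (C : Set (ℤ × ℤ)) (n : ℕ) :
    (boxFinset C n).card ≤ (2 * n + 1) ^ 2 := by
  classical
  refine (Finset.card_filter_le _ _).trans_eq ?_
  rw [Finset.card_product, Int.card_Icc, sq]
  congr 1 <;> omega

open Classical in
theorem weight_mul_area_le_card {C : Set (ℤ × ℤ)}
    (hC : IsIdCode (Real.sqrt 2) (2 - Real.sqrt 2) C) (n : ℕ) :
    12 * ((2 * n - 4) * (2 * n - 3)) ≤ 42 * (boxFinset C n).card := by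
  set B : Finset (ℤ × ℤ) := Finset.Icc (-n : ℤ) (n - 5) ×ˢ Finset.Icc (-n : ℤ) (n - 4) with hB
  have hcard : B.card = (2 * n - 4) * (2 * n - 3) := by
    rw [hB, Finset.card_product, Int.card_Icc, Int.card_Icc]
    congr 1 <;> omega
  have hshift (i : Fin 6) (j : Fin 5) :
      (∑ p ∈ B, if p + ((i : ℤ), (j : ℤ)) ∈ C then 1 else 0) ≤ (boxFinset C n).card := by
    rw [← Finset.card_filter]
    refine Finset.card_le_card_of_injOn (· + ((i : ℤ), (j : ℤ))) ?_
      (add_left_injective _).injOn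
    rintro ⟨x, y⟩ hp
    simp only [hB, Finset.coe_filter, Finset.mem_product, Finset.mem_Icc, Set.mem_ofPred_eq] at hp
    simp only [boxFinset, Finset.coe_filter, Finset.mem_product, Finset.mem_Icc,
      Set.mem_ofPred_eq]
    refine ⟨?_, hp.2⟩
    simp only [Prod.mk_add_mk]
    have := i.isLt
    have := j.isLt
    omega
  calc 12 * ((2 * n - 4) * (2 * n - 3)) = ∑ _p ∈ B, 12 := by
        rw [Finset.sum_const, hcard, smul_eq_mul, mul_comm]
    _ ≤ ∑ p ∈ B, ∑ i : Fin 6, ∑ j : Fin 5,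
          windowWeight i j * if p + ((i : ℤ), (j : ℤ)) ∈ C then 1 else 0 :=
        Finset.sum_le_sum fun p _ => twelve_le_sum_windowWeight hC p
    _ = ∑ i : Fin 6, ∑ j : Fin 5, windowWeight i j *
          ∑ p ∈ B, if p + ((i : ℤ), (j : ℤ)) ∈ C then 1 else 0 := by
        rw [Finset.sum_comm]
        refine Finset.sum_congr rfl fun i _ => ?_
        rw [Finset.sum_comm]
        simp only [Finset.mul_sum]
    _ ≤ ∑ i : Fin 6, ∑ j : Fin 5, windowWeight i j * (boxFinset C n).card := by
        gcongr with i _ j _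
        exact hshift i j
    _ = 42 * (boxFinset C n).card := by
        simp only [← Finset.sum_mul]
        congr 1

theorem stmt18 (C : Set (ℤ × ℤ))
    (hC : IsIdCode (Real.sqrt 2) (2 - Real.sqrt 2) C) :
    density C ≥ 16 / 57 := by
  refine Filter.le_limsup_of_frequently_le (Filter.Eventually.frequently ?_) ?_
  · filter_upwards [Filter.eventually_ge_atTop 1000] with n hn
    rw [natCard_inter_Qset, le_div_iff₀ (by positivity)]
    have h := weight_mul_area_le_card hC n
    have h' : (12 : ℝ) * ((2 * n - 4) * (2 * n - 3)) ≤ 42 * (boxFinset C n).card := by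
      rw [← Nat.cast_le (α := ℝ)] at h
      push_cast [show 4 ≤ 2 * n by omega, show 3 ≤ 2 * n by omega] at h
      exact h
    have hn' : (1000 : ℝ) ≤ n := by exact_mod_cast hn
    nlinarith
  · refine Filter.isBoundedUnder_of ⟨1, fun n => ?_⟩
    rw [natCard_inter_Qset]
    refine div_le_one_of_le₀ ?_ (by positivity)
    exact_mod_cast card_boxFinset_le C n
end

section
/- Every (√8, 3−√8)-identifying code C ⊆ ℤ² satisfies D(C) ≥ 1/7; that is, D(√8, 3−√8) ≥ 1/7. -/
open Filter

theorem mem_ball_iff_of_sq_eq {r : ℝ} {m : ℤ} (hr : r ^ 2 = m) (u v : ℤ × ℤ) :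
    v ∈ ball r u ↔ (v.1 - u.1) ^ 2 + (v.2 - u.2) ^ 2 ≤ m := by
  rw [ball, Set.mem_ofPred_eq, hr]
  exact_mod_cast Iff.rfl

theorem sub_eq_of_sq_add_sq_le_of_lt {a b : ℤ} (h₁ : a ^ 2 + b ^ 2 ≤ 8)
    (h₂ : 9 < (a - 1) ^ 2 + b ^ 2) : a = -2 ∧ (b = -2 ∨ b = -1 ∨ b = 1 ∨ b = 2) := by
  have ha : -2 ≤ a := by nlinarith [sq_nonneg b]
  have ha' : a ≤ 2 := by nlinarith [sq_nonneg b]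
  have hb : -2 ≤ b := by nlinarith [sq_nonneg a]
  have hb' : b ≤ 2 := by nlinarith [sq_nonneg a]
  interval_cases a <;> interval_cases b <;> simp_all

/-- Separating horizontally adjacent points forces a codeword in one of two columns at distance
five, in one of the four rows at distance one or two. -/
theorem IsIdCode.exists_mem_column_pair {C : Set (ℤ × ℤ)}
    (hC : IsIdCode (Real.sqrt 8) (3 - Real.sqrt 8) C) (x y : ℤ) :
    ∃ b : ℤ, (b = -2 ∨ b = -1 ∨ b = 1 ∨ b = 2) ∧ ((x, y + b) ∈ C ∨ (x + 5, y + b) ∈ C) := by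
  have h8 : Real.sqrt 8 ^ 2 = (8 : ℤ) := by norm_num
  have h9 : (Real.sqrt 8 + (3 - Real.sqrt 8)) ^ 2 = (9 : ℤ) := by norm_num
  obtain ⟨⟨p, q⟩, hS, hpC⟩ := hC.2 (x + 2, y) (x + 3, y) (by simp)
  simp only [Spat, Set.mem_union, Set.mem_sdiff, mem_ball_iff_of_sq_eq h8,
    mem_ball_iff_of_sq_eq h9, not_le] at hS
  refine ⟨q - y, ?_⟩
  rcases hS with ⟨h₁, h₂⟩ | ⟨h₁, h₂⟩
  · obtain ⟨ha, hb⟩ := sub_eq_of_sq_add_sq_le_of_lt h₁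
      (by rwa [show p - (x + 2) - 1 = p - (x + 3) by ring])
    obtain rfl : p = x := by omega
    exact ⟨hb, .inl (by simpa using hpC)⟩
  · obtain ⟨ha, hb⟩ := sub_eq_of_sq_add_sq_le_of_lt (a := x + 3 - p) (b := q - y)
      (by rwa [← neg_sub p, neg_sq])
      (by rwa [show x + 3 - p - 1 = -(p - (x + 2)) by ring, neg_sq])
    obtain rfl : p = x + 5 := by omega
    exact ⟨hb, .inr (by simpa using hpC)⟩

open Classical in
/-- The two column segments of height seven at horizontal distance five hold two codewords. -/
theorem IsIdCode.two_le_sum_column_pair {C : Set (ℤ × ℤ)}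
    (hC : IsIdCode (Real.sqrt 8) (3 - Real.sqrt 8) C) (x y : ℤ) :
    2 ≤ ∑ j ∈ Finset.range 7,
      ((if (x, y + j) ∈ C then 1 else 0) + if (x + 5, y + j) ∈ C then 1 else 0) := by
  have key (m : ℕ) (hm : 2 ≤ m) : ∃ j : ℕ, (j + 2 = m ∨ j + 1 = m ∨ j = m + 1 ∨ j = m + 2) ∧
      1 ≤ (if (x, y + j) ∈ C then 1 else 0) + if (x + 5, y + j) ∈ C then 1 else 0 := by
    obtain ⟨b, hb, h⟩ := hC.exists_mem_column_pair x (y + m)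
    refine ⟨(m + b).toNat, by omega, ?_⟩
    rw [show y + ((m + b).toNat : ℤ) = y + m + b by omega]
    rcases h with h | h <;> simp [h]
  generalize hg : (fun j : ℕ ↦
    (if (x, y + j) ∈ C then 1 else 0) + if (x + 5, y + j) ∈ C then 1 else 0) = g at *
  have key' (m : ℕ) (hm : 2 ≤ m) : 1 ≤ g (m - 2) + g (m - 1) + g (m + 1) + g (m + 2) := by
    obtain ⟨j, hj, h⟩ := key m hm
    rw [← hg]
    rcases hj with rfl | rfl | rfl | rfl <;> simp at h ⊢ <;> omega
  have h2 := key' 2 le_rfl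
  have h3 := key' 3 (by norm_num)
  have h4 := key' 4 (by norm_num)
  simp only [Finset.sum_range_succ, Finset.sum_range_zero]
  norm_num at h2 h3 h4
  omega

theorem mul_le_sum_range_mul_of_forall_le {h : ℕ → ℕ} {c p : ℕ}
    (hc : ∀ a, c ≤ ∑ j ∈ Finset.range p, h (a + j)) (m : ℕ) :
    c * m ≤ ∑ i ∈ Finset.range (p * m), h i := by
  induction m with
  | zero => simp
  | succ m ih =>
    rw [mul_add_one, mul_add_one, Finset.sum_range_add]
    exact add_le_add ih (hc _)

theorem Qset_finite (n : ℕ) : (Qset n).Finite :=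
  (Set.finite_Icc ((-n, -n) : ℤ × ℤ) (n, n)).subset fun _ hp ↦
    ⟨⟨(abs_le.1 hp.1).1, (abs_le.1 hp.2).1⟩, (abs_le.1 hp.1).2, (abs_le.1 hp.2).2⟩

theorem card_inter_Qset_le (C : Set (ℤ × ℤ)) (n : ℕ) :
    Nat.card ↥(C ∩ Qset n) ≤ (2 * n + 1) ^ 2 := by
  have h : C ∩ Qset n ⊆ (Finset.Icc (-n : ℤ) n ×ˢ Finset.Icc (-n : ℤ) n : Finset (ℤ × ℤ)) := by
    rintro p ⟨-, hp⟩
    rw [Finset.coe_product]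
    exact ⟨Finset.mem_coe.2 (Finset.mem_Icc.2 (abs_le.1 hp.1)),
      Finset.mem_coe.2 (Finset.mem_Icc.2 (abs_le.1 hp.2))⟩
  have := Set.ncard_le_ncard h (Finset.finite_toSet _)
  rw [Set.ncard_coe_finset, Finset.card_product, Int.card_Icc,
    show ((n : ℤ) + 1 - -n).toNat = 2 * n + 1 by omega, ← sq] at this
  exact this

open Classical in
theorem sum_sum_ite_mem_le_card_inter_Qset (C : Set (ℤ × ℤ)) (n : ℕ) :
    ∑ i ∈ Finset.range (2 * n), ∑ j ∈ Finset.range (2 * n),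
      (if ((i : ℤ) - n, (j : ℤ) - n) ∈ C then 1 else 0) ≤ Nat.card ↥(C ∩ Qset n) := by
  rw [← Finset.sum_product', ← Finset.card_filter, Nat.card_coe_set_eq, ← Set.ncard_coe_finset]
  refine Set.ncard_le_ncard_of_injOn (fun q : ℕ × ℕ ↦ ((q.1 : ℤ) - n, (q.2 : ℤ) - n)) ?_ ?_
    ((Qset_finite n).subset Set.inter_subset_right)
  · intro q hq
    simp only [Finset.coe_filter, Finset.mem_product, Finset.mem_range, Set.mem_ofPred_eq] at hq
    refine ⟨hq.2, abs_le.2 ⟨?_, ?_⟩, abs_le.2 ⟨?_, ?_⟩⟩ <;> simp only <;> omega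
  · rintro ⟨a, b⟩ - ⟨a', b'⟩ - h
    simp only [Prod.mk.injEq] at h ⊢
    omega

theorem IsIdCode.le_card_inter_Qset {C : Set (ℤ × ℤ)}
    (hC : IsIdCode (Real.sqrt 8) (3 - Real.sqrt 8) C) (k : ℕ) :
    700 * k ^ 2 ≤ Nat.card ↥(C ∩ Qset (35 * k)) := by
  classical
  refine le_trans ?_ (sum_sum_ite_mem_le_card_inter_Qset C (35 * k))
  set n := 35 * k with hn
  set g : ℕ → ℕ := fun i ↦ ∑ j ∈ Finset.range (2 * n),
    (if ((i : ℤ) - n, (j : ℤ) - n) ∈ C then 1 else 0) with hg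
  have pair (i : ℕ) : 20 * k ≤ g i + g (i + 5) := by
    have := mul_le_sum_range_mul_of_forall_le (c := 2) (p := 7) (m := 10 * k)
      (h := fun j ↦ (if ((i : ℤ) - n, (j : ℤ) - n) ∈ C then 1 else 0) +
        if ((i : ℤ) - n + 5, (j : ℤ) - n) ∈ C then 1 else 0) fun a ↦ by
      convert hC.two_le_sum_column_pair ((i : ℤ) - n) ((a : ℤ) - n) using 5 <;>
        push_cast <;> ring_nf
    rw [Finset.sum_add_distrib, show 7 * (10 * k) = 2 * n by omega] at this
    rw [hg]
    simp only
    push_cast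
    rw [show (i : ℤ) + 5 - n = i - n + 5 by ring]
    omega
  have := mul_le_sum_range_mul_of_forall_le (c := 100 * k) (p := 10) (m := 7 * k) (h := g)
    fun a ↦ by
      simp only [Finset.sum_range_succ, Finset.sum_range_zero]
      have h0 := pair a
      have h1 := pair (a + 1)
      have h2 := pair (a + 2)
      have h3 := pair (a + 3)
      have h4 := pair (a + 4)
      simp only [add_assoc, Nat.reduceAdd] at h0 h1 h2 h3 h4 ⊢
      simp only [add_zero]
      omega
  rw [show 10 * (7 * k) = 2 * n by omega] at this
  calc 700 * k ^ 2 = 100 * k * (7 * k) := by ring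
    _ ≤ _ := this

theorem tendsto_mul_sq_div_sq_atTop :
    Tendsto (fun k : ℕ ↦ 700 * (k : ℝ) ^ 2 / (70 * k + 1) ^ 2) atTop (nhds (1 / 7)) := by
  have h : Tendsto (fun k : ℕ ↦ 700 / (70 + 1 / (k : ℝ)) ^ 2) atTop
      (nhds (700 / (70 + 0) ^ 2)) :=
    (tendsto_const_nhds.div ((tendsto_one_div_atTop_nhds_zero_nat.const_add 70).pow 2)
      (by norm_num))
  norm_num at h
  norm_num
  refine h.congr' ?_
  filter_upwards [eventually_gt_atTop 0] with k hk
  have : (k : ℝ) ≠ 0 := by positivity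
  field_simp

theorem stmt19 (C : Set (ℤ × ℤ))
    (hC : IsIdCode (Real.sqrt 8) (3 - Real.sqrt 8) C) :
    density C ≥ 1 / 7 := by
  have hbdd : IsBoundedUnder (· ≤ ·) atTop
      fun n : ℕ ↦ (Nat.card ↥(C ∩ Qset n) : ℝ) / (2 * (n : ℝ) + 1) ^ 2 := by
    refine isBoundedUnder_of ⟨1, fun n ↦ div_le_one_of_le₀ ?_ (by positivity)⟩
    exact_mod_cast card_inter_Qset_le C n
  refine le_of_forall_lt fun a ha ↦ ?_
  obtain ⟨b, hab, hb⟩ := exists_between ha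
  refine hab.trans_le (le_limsup_of_frequently_le ?_ hbdd)
  have hmul : Tendsto (fun k : ℕ ↦ 35 * k) atTop atTop :=
    tendsto_id.const_mul_atTop' (by norm_num)
  refine hmul.frequently (Eventually.frequently ?_)
  filter_upwards [tendsto_mul_sq_div_sq_atTop.eventually_const_lt hb] with k hk
  refine hk.le.trans ?_
  push_cast
  rw [← mul_assoc, show (2 : ℝ) * 35 = 70 by norm_num]
  gcongr
  exact_mod_cast hC.le_card_inter_Qset k
end
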